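/- arXiv:1005.3233 — 2 statements merged into one kernel-verified Lean document; each statement's English description precedes it below -/
import Mathlib

section
/- For any function f : ℕ → ℝ and any N ≥ 1, the sum over all binary sequences ξ of length N containing at least one success of the product ∏_l f(l)^{n_l(ξ)} equals Σ_{r=1}^{N} Σ_{M=1}^{min(r, N−r+1)} Σ_{π} [∏_l f(l)^{n_l}] · (N − r + 2 − M)_M / ∏_l n_l!, where the inner sum runs over all partitions π of r into exactly M parts and n_l denotes the number of parts of π (respectively, the number of success runs of ξ) equal to l. -/
/-- The multiset of lengths of the success runs (maximal blocks of consecutive `true`s)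
of a binary sequence `ξ`, where `true` denotes success. -/
def runType {N : ℕ} (ξ : Fin N → Bool) : Multiset ℕ :=
  ↑((((List.ofFn ξ).splitOn false).map List.length).filter (· ≠ 0))

/-- The number of successes of `ξ`: the number of indices mapped to success (`true`). -/
def successCount {N : ℕ} (ξ : Fin N → Bool) : ℕ :=
  (Finset.univ.filter fun i => ξ i = true).card

/-- The lengths, in order and with zeros, of the blocks of `true`s delimited by the `false`s. -/
def blockLengths (l : List Bool) : List ℕ :=
  (l.splitOn false).map List.length

lemma blockLengths_nil : blockLengths [] = [0] := by
  simp [blockLengths]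

lemma blockLengths_cons_false (l : List Bool) :
    blockLengths (false :: l) = 0 :: blockLengths l := by
  simp [blockLengths, List.splitOn, List.splitOnP_cons_eq_if_modifyHead]

lemma blockLengths_cons_true (l : List Bool) :
    blockLengths (true :: l) = (blockLengths l).modifyHead Nat.succ := by
  simp only [blockLengths, List.splitOn, List.splitOnP_cons_eq_if_modifyHead]
  cases List.splitOnP (fun b => b == false) l <;> simp

lemma blockLengths_ne_nil (l : List Bool) : blockLengths l ≠ [] := by
  simp [blockLengths, List.splitOn, List.splitOnP_ne_nil]

lemma sum_add_length_blockLengths (l : List Bool) :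
    (blockLengths l).sum + (blockLengths l).length = l.length + 1 := by
  induction l with
  | nil => simp [blockLengths_nil]
  | cons b l ih =>
    cases b
    · simp only [blockLengths_cons_false, List.sum_cons, List.length_cons]
      omega
    · rw [blockLengths_cons_true]
      cases h : blockLengths l with
      | nil => exact absurd h (blockLengths_ne_nil l)
      | cons a t =>
        rw [h] at ih
        simp only [List.modifyHead_cons, List.sum_cons, List.length_cons] at ih ⊢
        omega

lemma blockLengths_cons_false_ne_cons_true (l l' : List Bool) :
    blockLengths (false :: l) ≠ blockLengths (true :: l') := by
  rw [blockLengths_cons_false, blockLengths_cons_true]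
  cases blockLengths l' <;> simp

lemma blockLengths_injective : Function.Injective blockLengths := by
  intro l
  induction l with
  | nil =>
    intro l' h
    have h1 := sum_add_length_blockLengths l'
    rw [← h, blockLengths_nil] at h1
    simpa [eq_comm] using h1
  | cons b l ih =>
    intro l' h
    cases l' with
    | nil =>
      have h1 := sum_add_length_blockLengths (b :: l)
      rw [h, blockLengths_nil] at h1
      simp at h1
    | cons b' l' =>
      cases b <;> cases b'
      · rw [blockLengths_cons_false, blockLengths_cons_false] at h
        rw [ih (List.cons.inj h).2]
      · exact absurd h (blockLengths_cons_false_ne_cons_true _ _)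
      · exact absurd h.symm (blockLengths_cons_false_ne_cons_true _ _)
      · rw [blockLengths_cons_true, blockLengths_cons_true] at h
        rw [@ih l']
        have h1 := blockLengths_ne_nil l
        have h2 := blockLengths_ne_nil l'
        cases hl : blockLengths l <;> cases hl' : blockLengths l' <;> simp_all

lemma exists_blockLengths_eq (L : List ℕ) (hL : L ≠ []) : ∃ l, blockLengths l = L := by
  induction L with
  | nil => exact absurd rfl hL
  | cons a t ih =>
    induction a with
    | zero =>
      by_cases ht : t = []
      · exact ⟨[], by rw [ht, blockLengths_nil]⟩
      · obtain ⟨l, hl⟩ := ih ht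
        exact ⟨false :: l, by rw [blockLengths_cons_false, hl]⟩
    | succ a iha =>
      obtain ⟨l, hl⟩ := iha (by simp)
      exact ⟨true :: l, by rw [blockLengths_cons_true, hl]; rfl⟩

lemma Multiset.mem_lists_toFinset {α : Type*} [DecidableEq α] (s : Multiset α) (l : List α) :
    l ∈ s.lists.toFinset ↔ (l : Multiset α) = s := by
  rw [Multiset.mem_toFinset, Multiset.mem_lists_iff, eq_comm, Multiset.quot_mk_to_coe]

lemma Multiset.lists_toFinset_eq_biUnion {α : Type*} [DecidableEq α] (s : Multiset α)
    (hs : s ≠ 0) :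
    s.lists.toFinset =
      s.toFinset.biUnion fun a => (s.erase a).lists.toFinset.image (List.cons a) := by
  ext l
  rw [Multiset.mem_lists_toFinset]
  simp only [Finset.mem_biUnion, Finset.mem_image, ↓Multiset.mem_lists_toFinset]
  simp only [Multiset.mem_toFinset]
  constructor
  · rintro rfl
    cases l with
    | nil => simp at hs
    | cons a t => exact ⟨a, by simp, t, by simp, rfl⟩
  · rintro ⟨a, ha, t, ht, rfl⟩
    rw [← Multiset.cons_coe, ht, Multiset.cons_erase ha]

lemma Multiset.prod_factorial_count_eq_count_mul {α : Type*} [DecidableEq α] (s : Multiset α)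
    (T : Finset α) {a : α} (ha : a ∈ s) (haT : a ∈ T) :
    ∏ b ∈ T, (s.count b).factorial =
      s.count a * ∏ b ∈ T, ((s.erase a).count b).factorial := by
  rw [← Finset.mul_prod_erase _ _ haT, ← Finset.mul_prod_erase T _ haT, ← mul_assoc,
    Multiset.count_erase_self, Nat.mul_factorial_pred (Multiset.count_pos.2 ha).ne']
  congr 1
  refine Finset.prod_congr rfl fun b hb => ?_
  rw [Multiset.count_erase_of_ne (Finset.ne_of_mem_erase hb)]

/-- The number of orderings of a multiset, times the factorials of its multiplicities, is the
factorial of its cardinality. -/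
lemma Multiset.card_lists_toFinset_mul_prod_factorial {α : Type*} [DecidableEq α]
    (s : Multiset α) (T : Finset α) (hT : ∀ a ∈ s, a ∈ T) :
    s.lists.toFinset.card * ∏ a ∈ T, (s.count a).factorial = (card s).factorial := by
  induction hn : card s generalizing s with
  | zero =>
    obtain rfl := Multiset.card_eq_zero.1 hn
    have : (0 : Multiset α).lists.toFinset = {[]} := by
      ext l
      rw [Multiset.mem_lists_toFinset, Multiset.coe_eq_zero, Finset.mem_singleton]
    simp [this]
  | succ n ih =>
    have hs : s ≠ 0 := by
      rintro rfl
      simp at hn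
    rw [Multiset.lists_toFinset_eq_biUnion s hs, Finset.card_biUnion, Finset.sum_mul]
    · calc
        _ = ∑ a ∈ s.toFinset, s.count a * n.factorial := by
          refine Finset.sum_congr rfl fun a ha => ?_
          rw [Multiset.mem_toFinset] at ha
          rw [Finset.card_image_of_injective _ (List.cons_injective),
            s.prod_factorial_count_eq_count_mul T ha (hT a ha), mul_left_comm,
            ih (s.erase a) (fun b hb => hT b (Multiset.mem_of_mem_erase hb))
              (by rw [Multiset.card_erase_of_mem ha, hn]; rfl)]
        _ = (n + 1).factorial := by
          rw [← Finset.sum_mul, Multiset.toFinset_sum_count_eq, hn, Nat.factorial_succ]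
    · intro a _ b _ hab
      rw [Function.onFun, Finset.disjoint_left]
      intro l hl hl'
      simp only [Finset.mem_image] at hl hl'
      obtain ⟨t, _, rfl⟩ := hl
      obtain ⟨t', _, h⟩ := hl'
      exact hab (List.cons.inj h).1.symm

lemma runType_eq_filter_blockLengths {N : ℕ} (ξ : Fin N → Bool) :
    runType ξ = (blockLengths (List.ofFn ξ) : Multiset ℕ).filter (· ≠ 0) := by
  simp [runType, blockLengths]

lemma zero_notMem_runType {N : ℕ} (ξ : Fin N → Bool) : 0 ∉ runType ξ := by
  simp [runType_eq_filter_blockLengths]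

lemma Multiset.filter_ne_zero_add_replicate (s : Multiset ℕ) :
    s.filter (· ≠ 0) + replicate (s.count 0) 0 = s := by
  conv_rhs => rw [← Multiset.filter_add_not (· ≠ 0) s]
  simp [Multiset.filter_eq']

lemma blockLengths_eq_runType_add {N : ℕ} (ξ : Fin N → Bool) :
    (blockLengths (List.ofFn ξ) : Multiset ℕ) =
      runType ξ + Multiset.replicate ((blockLengths (List.ofFn ξ) : Multiset ℕ).count 0) 0 := by
  rw [runType_eq_filter_blockLengths, Multiset.filter_ne_zero_add_replicate]

lemma sum_add_card_add_count_zero {N : ℕ} (ξ : Fin N → Bool) :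
    (runType ξ).sum + (Multiset.card (runType ξ) +
      (blockLengths (List.ofFn ξ) : Multiset ℕ).count 0) = N + 1 := by
  have h := sum_add_length_blockLengths (List.ofFn ξ)
  rw [← Multiset.sum_coe, ← Multiset.coe_card, blockLengths_eq_runType_add ξ] at h
  simpa using h

lemma runType_eq_iff {N : ℕ} (ξ : Fin N → Bool) (m : Multiset ℕ) (hm : 0 ∉ m) :
    runType ξ = m ↔ (blockLengths (List.ofFn ξ) : Multiset ℕ) =
      m + Multiset.replicate (N + 1 - m.sum - Multiset.card m) 0 := by
  constructor
  · rintro rfl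
    have h := sum_add_card_add_count_zero ξ
    have h2 : N + 1 - (runType ξ).sum - Multiset.card (runType ξ) =
        (blockLengths (List.ofFn ξ) : Multiset ℕ).count 0 := by omega
    rw [h2]
    exact blockLengths_eq_runType_add ξ
  · intro h
    rw [runType_eq_filter_blockLengths, h, Multiset.filter_add,
      Multiset.filter_eq_self.2 fun a ha => ne_of_mem_of_not_mem ha hm,
      Multiset.filter_eq_nil.2 fun a ha => by simp [Multiset.eq_of_mem_replicate ha], add_zero]

lemma card_runType_eq_card_lists (N : ℕ) (m : Multiset ℕ) (hm : 0 ∉ m)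
    (h : m.sum + Multiset.card m ≤ N + 1) :
    (Finset.univ.filter fun ξ : Fin N → Bool => runType ξ = m).card =
      (m + Multiset.replicate (N + 1 - m.sum - Multiset.card m) 0).lists.toFinset.card := by
  refine Finset.card_bij (fun ξ _ => blockLengths (List.ofFn ξ)) ?_ ?_ ?_
  · intro ξ hξ
    rw [Multiset.mem_lists_toFinset]
    exact (runType_eq_iff ξ m hm).1 (Finset.mem_filter.1 hξ).2
  · intro ξ _ ξ' _ h
    exact List.ofFn_injective (blockLengths_injective h)
  · intro L hL
    rw [Multiset.mem_lists_toFinset] at hL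
    have hsum : L.sum + L.length = N + 1 := by
      rw [← Multiset.sum_coe, ← Multiset.coe_card, hL]
      simp
      omega
    have hne : L ≠ [] := by
      rintro rfl
      simp at hsum
    obtain ⟨l, rfl⟩ := exists_blockLengths_eq L hne
    rw [sum_add_length_blockLengths, Nat.add_right_cancel_iff] at hsum
    subst hsum
    refine ⟨l.get, ?_, by rw [List.ofFn_get]⟩
    rw [Finset.mem_filter, runType_eq_iff _ _ hm, List.ofFn_get]
    exact ⟨Finset.mem_univ _, hL⟩

lemma Multiset.mem_Icc_one_sum {m : Multiset ℕ} (hm : 0 ∉ m) {a : ℕ} (ha : a ∈ m) :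
    a ∈ Finset.Icc 1 m.sum :=
  Finset.mem_Icc.2 ⟨Nat.one_le_iff_ne_zero.2 (ne_of_mem_of_not_mem ha hm),
    Multiset.le_sum_of_mem ha⟩

lemma card_runType_mul_prod_factorial (N : ℕ) (m : Multiset ℕ) (hm : 0 ∉ m)
    (h : m.sum + Multiset.card m ≤ N + 1) :
    (Finset.univ.filter fun ξ : Fin N → Bool => runType ξ = m).card *
        ∏ l ∈ Finset.Icc 1 m.sum, (m.count l).factorial =
      (N + 1 - m.sum).descFactorial (Multiset.card m) := by
  have key := (m + Multiset.replicate (N + 1 - m.sum - Multiset.card m)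
    0).card_lists_toFinset_mul_prod_factorial (insert 0 (Finset.Icc 1 m.sum)) (by
      intro a ha
      rcases Multiset.mem_add.1 ha with ha | ha
      · exact Finset.mem_insert_of_mem (Multiset.mem_Icc_one_sum hm ha)
      · simp [Multiset.eq_of_mem_replicate ha])
  rw [← card_runType_eq_card_lists N m hm h, Finset.prod_insert (by simp)] at key
  have hprod : ∏ l ∈ Finset.Icc 1 m.sum,
      ((m + Multiset.replicate (N + 1 - m.sum - Multiset.card m) 0).count l).factorial =
        ∏ l ∈ Finset.Icc 1 m.sum, (m.count l).factorial := by
    refine Finset.prod_congr rfl fun l hl => ?_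
    have hl0 : (0 : ℕ) ≠ l := by
      have := (Finset.mem_Icc.1 hl).1
      omega
    rw [Multiset.count_add, Multiset.count_replicate, if_neg hl0, add_zero]
  have hcard : Multiset.card (m + Multiset.replicate (N + 1 - m.sum - Multiset.card m) 0) =
      N + 1 - m.sum := by
    rw [Multiset.card_add, Multiset.card_replicate]
    omega
  rw [hprod, hcard, Multiset.count_add, Multiset.count_replicate_self,
    Multiset.count_eq_zero_of_notMem hm, zero_add,
    ← Nat.factorial_mul_descFactorial (show Multiset.card m ≤ N + 1 - m.sum by omega)] at key
  refine Nat.eq_of_mul_eq_mul_left (Nat.factorial_pos (N + 1 - m.sum - Multiset.card m)) ?_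
  rw [← key]
  ring

lemma card_runType_eq_ascPochhammer (N : ℕ) (m : Multiset ℕ) (hm : 0 ∉ m)
    (h : m.sum + Multiset.card m ≤ N + 1) :
    ((Finset.univ.filter fun ξ : Fin N → Bool => runType ξ = m).card : ℝ) =
      Polynomial.eval ((N : ℝ) - m.sum + 2 - Multiset.card m)
          (ascPochhammer ℝ (Multiset.card m)) /
        ∏ l ∈ Finset.Icc 1 m.sum, (Nat.factorial (m.count l) : ℝ) := by
  rw [eq_div_iff (Finset.prod_ne_zero_iff.2 fun l _ => by positivity)]
  have key := congrArg (Nat.cast : ℕ → ℝ) (card_runType_mul_prod_factorial N m hm h)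
  push_cast at key
  rw [key]
  have hx : (N : ℝ) - m.sum + 2 - Multiset.card m =
      ((N + 2 - m.sum - Multiset.card m : ℕ) : ℝ) := by
    rw [Nat.cast_sub (by omega), Nat.cast_sub (by omega)]
    push_cast
    ring
  rw [hx, ← ascPochhammer_eval_cast, ascPochhammer_nat_eq_descFactorial]
  congr 2
  omega

lemma Multiset.card_le_sum_of_zero_notMem {m : Multiset ℕ} (hm : 0 ∉ m) : card m ≤ m.sum := by
  have h := Multiset.card_nsmul_le_sum (s := m) (a := 1) fun x hx =>
    Nat.one_le_iff_ne_zero.2 (ne_of_mem_of_not_mem hx hm)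
  simpa using h

lemma runType_replicate_false (N : ℕ) : runType (fun _ : Fin N => false) = 0 := by
  have h (n : ℕ) : blockLengths (List.replicate n false) = List.replicate (n + 1) 0 := by
    induction n with
    | zero => exact blockLengths_nil
    | succ n ih => rw [List.replicate_succ, blockLengths_cons_false, ih, ← List.replicate_succ]
  rw [runType_eq_filter_blockLengths, List.ofFn_const, h, Multiset.filter_eq_nil]
  simp

lemma runType_eq_zero_iff {N : ℕ} (ξ : Fin N → Bool) : runType ξ = 0 ↔ ∀ i, ξ i = false := by
  constructor
  · intro h
    have h1 := blockLengths_eq_runType_add ξ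
    have h2 := blockLengths_eq_runType_add fun _ : Fin N => false
    have h3 := sum_add_card_add_count_zero ξ
    have h4 := sum_add_card_add_count_zero fun _ : Fin N => false
    rw [h] at h1 h3
    rw [runType_replicate_false] at h2 h4
    have h5 : (blockLengths (List.ofFn ξ) : Multiset ℕ).count 0 =
        (blockLengths (List.ofFn fun _ : Fin N => false) : Multiset ℕ).count 0 := by
      simp only [Multiset.sum_zero, Multiset.card_zero] at h3 h4
      omega
    rw [h5, zero_add, ← Multiset.coe_replicate, Multiset.coe_eq_coe,
      List.perm_replicate] at h1
    rw [zero_add, ← Multiset.coe_replicate, Multiset.coe_eq_coe, List.perm_replicate] at h2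
    exact congrFun (List.ofFn_injective (blockLengths_injective (h1.trans h2.symm)))
  · intro h
    rw [show ξ = fun _ => false from funext h, runType_replicate_false]

lemma one_le_card_runType_iff {N : ℕ} (ξ : Fin N → Bool) :
    1 ≤ Multiset.card (runType ξ) ↔ ∃ i, ξ i = true := by
  rw [Nat.one_le_iff_ne_zero, ne_eq, Multiset.card_eq_zero, runType_eq_zero_iff]
  simp

lemma sum_filter_runType_eq_sum_partition (N r M : ℕ) (F : (Fin N → Bool) → ℝ) :
    ∑ ξ ∈ Finset.univ.filter (fun ξ : Fin N → Bool =>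
        (runType ξ).sum = r ∧ Multiset.card (runType ξ) = M), F ξ =
      ∑ π ∈ Finset.univ.filter (fun π : Nat.Partition r => Multiset.card π.parts = M),
        ∑ ξ ∈ Finset.univ.filter (fun ξ : Fin N → Bool => runType ξ = π.parts), F ξ := by
  rw [← Finset.sum_biUnion]
  · congr 1
    ext ξ
    simp only [Finset.mem_filter, Finset.mem_univ, true_and, Finset.mem_biUnion]
    constructor
    · rintro ⟨hr, hM⟩
      exact ⟨⟨runType ξ, fun {i} hi =>
        Nat.pos_of_ne_zero (ne_of_mem_of_not_mem hi (zero_notMem_runType ξ)), hr⟩, hM, rfl⟩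
    · rintro ⟨π, hM, h⟩
      rw [h]
      exact ⟨π.parts_sum, hM⟩
  · intro π _ π' _ hne
    rw [Function.onFun, Finset.disjoint_left]
    intro ξ hξ hξ'
    exact hne (Nat.Partition.ext
      ((Finset.mem_filter.1 hξ).2.symm.trans (Finset.mem_filter.1 hξ').2))

lemma prod_pow_count_Icc_eq (f : ℕ → ℝ) (m : Multiset ℕ) (hm : 0 ∉ m) {N : ℕ}
    (hN : m.sum ≤ N) :
    ∏ l ∈ Finset.Icc 1 N, f l ^ m.count l = ∏ l ∈ Finset.Icc 1 m.sum, f l ^ m.count l := by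
  refine (Finset.prod_subset (Finset.Icc_subset_Icc_right hN) fun l _ hl => ?_).symm
  rw [Multiset.count_eq_zero_of_notMem fun h => hl (Multiset.mem_Icc_one_sum hm h), pow_zero]

/-- For any `f : ℕ → ℝ` and `N ≥ 1`, the sum over all binary sequences `ξ` of length `N`
containing at least one success of `∏_l f(l)^{n_l(ξ)}` (where `n_l(ξ)` is the number of
success runs of `ξ` of length exactly `l`) equals
`∑_{r=1}^{N} ∑_{M=1}^{min(r, N-r+1)} ∑_{π} [∏_l f(l)^{n_l}] ⬝ (N - r + 2 - M)_M / ∏_l n_l!`,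
the inner sum running over all partitions `π` of `r` into exactly `M` parts, `n_l` being the
number of parts of `π` equal to `l`, and `(x)_n` the ascending Pochhammer symbol. -/
theorem sum_over_sequences_eq_sum_over_partitions (N : ℕ) (hN : 1 ≤ N) (f : ℕ → ℝ) :
    ∑ ξ ∈ Finset.univ.filter (fun ξ : Fin N → Bool => ∃ i, ξ i = true),
        ∏ l ∈ Finset.Icc 1 N, f l ^ ((runType ξ).count l)
      = ∑ r ∈ Finset.Icc 1 N, ∑ M ∈ Finset.Icc 1 (min r (N - r + 1)),
          ∑ π ∈ Finset.univ.filter (fun π : Nat.Partition r => Multiset.card π.parts = M),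
            (∏ l ∈ Finset.Icc 1 r, f l ^ (π.parts.count l))
              * Polynomial.eval ((N : ℝ) - r + 2 - M) (ascPochhammer ℝ M)
              / ∏ l ∈ Finset.Icc 1 r, (Nat.factorial (π.parts.count l) : ℝ) := by
  have hmem (ξ : Fin N → Bool) (hξ : ∃ i, ξ i = true) :
      (runType ξ).sum ∈ Finset.Icc 1 N ∧ Multiset.card (runType ξ) ∈
        Finset.Icc 1 (min (runType ξ).sum (N - (runType ξ).sum + 1)) := by
    have h1 := (one_le_card_runType_iff ξ).2 hξ
    have h2 := Multiset.card_le_sum_of_zero_notMem (zero_notMem_runType ξ)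
    have h3 := sum_add_card_add_count_zero ξ
    simp only [Finset.mem_Icc, le_min_iff]
    omega
  rw [← Finset.sum_fiberwise_of_maps_to (g := fun ξ => (runType ξ).sum)
    (t := Finset.Icc 1 N) fun ξ hξ => (hmem ξ (Finset.mem_filter.1 hξ).2).1]
  refine Finset.sum_congr rfl fun r hr => ?_
  rw [← Finset.sum_fiberwise_of_maps_to (g := fun ξ => Multiset.card (runType ξ))
    (t := Finset.Icc 1 (min r (N - r + 1))) fun ξ hξ => by
      obtain ⟨h, rfl⟩ := Finset.mem_filter.1 hξ
      exact (hmem ξ (Finset.mem_filter.1 h).2).2]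
  refine Finset.sum_congr rfl fun M hM => ?_
  rw [Finset.mem_Icc, le_min_iff] at hM
  rw [Finset.mem_Icc] at hr
  have hfilter : (((Finset.univ.filter fun ξ : Fin N → Bool => ∃ i, ξ i = true).filter
      fun ξ => (runType ξ).sum = r).filter fun ξ => Multiset.card (runType ξ) = M) =
      Finset.univ.filter fun ξ : Fin N → Bool =>
        (runType ξ).sum = r ∧ Multiset.card (runType ξ) = M := by
    ext ξ
    simp only [Finset.mem_filter, Finset.mem_univ, true_and, ← one_le_card_runType_iff]
    constructor
    · rintro ⟨⟨-, h⟩, h'⟩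
      exact ⟨h, h'⟩
    · rintro ⟨h, h'⟩
      exact ⟨⟨h' ▸ hM.1, h⟩, h'⟩
  rw [hfilter, sum_filter_runType_eq_sum_partition]
  refine Finset.sum_congr rfl fun π hπ => ?_
  have hcard : Multiset.card π.parts = M := (Finset.mem_filter.1 hπ).2
  have h0 : 0 ∉ π.parts := fun h => (π.parts_pos h).ne' rfl
  have hsum := π.parts_sum
  have hconst : ∀ ξ ∈ Finset.univ.filter (fun ξ : Fin N → Bool => runType ξ = π.parts),
      ∏ l ∈ Finset.Icc 1 N, f l ^ (runType ξ).count l =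
        ∏ l ∈ Finset.Icc 1 r, f l ^ π.parts.count l := by
    intro ξ hξ
    rw [(Finset.mem_filter.1 hξ).2, prod_pow_count_Icc_eq f _ h0 (by omega), hsum]
  rw [Finset.sum_congr rfl hconst, Finset.sum_const, nsmul_eq_mul,
    card_runType_eq_ascPochhammer N π.parts h0 (by omega), hsum, hcard]
  ring
end

section
/- Let N ≥ 1 and let X₁, …, X_N be independent random variables with X_i normally distributed with mean μ_i and variance σ_i² (μ_i real, σ_i > 0). Call index i a success if X_i > μ_i; a success run is a maximal block of consecutive success indices A with weight Σ_{i∈A} (X_i − μ_i)²/σ_i², and T is the maximum weight over success runs. Then for every real t > 0, the conditional probability P(T < t | at least one success occurs) equals (1/(2^N − 1)) · Σ_{r=1}^{N} Σ_{M=1}^{min(r, N−r+1)} Σ_{π} [∏_l F_l(t)^{n_l}] · (N − r + 2 − M)_M / ∏_l n_l!, where the inner sum runs over all partitions π of r into exactly M parts, n_l is the number of parts of π equal to l, (x)_n = x(x+1)···(x+n−1), and F_l(t) = γ(l/2, t/2)/Γ(l/2) is the cumulative distribution function at t of the chi-squared distribution with l degrees of freedom. -/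
open MeasureTheory ProbabilityTheory

/-- `IsSuccessRun succ A` says that the finite set `A` of indices is a success run for the
success predicate `succ`: `A` is a nonempty maximal block of consecutive success indices,
i.e. `A` is nonempty, consists of successes, is an interval of consecutive indices, and
cannot be extended by an adjacent success index. -/
def IsSuccessRun {N : ℕ} (succ : Fin N → Prop) (A : Finset (Fin N)) : Prop :=
  A.Nonempty ∧ (∀ i ∈ A, succ i) ∧
    (∀ i ∈ A, ∀ j ∈ A, ∀ k, i ≤ k → k ≤ j → k ∈ A) ∧
    (∀ i : Fin N, succ i → (∃ j ∈ A, (i : ℕ) + 1 = (j : ℕ) ∨ (j : ℕ) + 1 = (i : ℕ)) → i ∈ A)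

/-- `F l t = γ(l/2, t/2) / Γ(l/2)`: the cumulative distribution function at `t` of the
chi-squared distribution with `l` degrees of freedom, where
`γ(a, x) = ∫₀ˣ s^{a-1} e^{-s} ds` is the lower incomplete gamma function. -/
noncomputable def chiSqCDF (l : ℕ) (t : ℝ) : ℝ :=
  (∫ s in (0 : ℝ)..(t / 2), s ^ ((l : ℝ) / 2 - 1) * Real.exp (-s)) / Real.Gamma ((l : ℝ) / 2)

open Finset.HasAntidiagonal (antidiagonal)

/-- The sum, over all ways to write `n = ∑ (aᵢ + 1)` as an ordered sum, of `∏ f aᵢ`. When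
`f 0 = 1`, the value at `N + 1` is the sum over all subsets of `N` consecutive indices of the
product of `f` over the lengths of the maximal blocks of the subset. -/
noncomputable def runSum {R : Type*} [CommSemiring R] (f : ℕ → R) (n : ℕ) : R :=
  ∑ p ∈ antidiagonal n, PowerSeries.coeff p.2 (PowerSeries.mk f ^ p.1)

lemma runSum_zero {R : Type*} [CommSemiring R] (f : ℕ → R) : runSum f 0 = 1 := by
  simp [runSum]

lemma runSum_succ {R : Type*} [CommSemiring R] (f : ℕ → R) (n : ℕ) :
    runSum f (n + 1) = ∑ p ∈ antidiagonal n, f p.1 * runSum f p.2 := by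
  simp only [runSum, Finset.mul_sum]
  rw [Finset.Nat.sum_antidiagonal_succ]
  simp only [pow_zero, PowerSeries.coeff_one, Nat.add_eq_zero_iff, one_ne_zero, and_false,
    if_false, zero_add, pow_succ', PowerSeries.coeff_mul, PowerSeries.coeff_mk]
  rw [Finset.sum_sigma', Finset.sum_sigma']
  refine Finset.sum_nbij' (fun x => ⟨(x.2.1, x.1.1 + x.2.2), (x.1.1, x.2.2)⟩)
    (fun x => ⟨(x.2.1, x.1.1 + x.2.2), (x.1.1, x.2.2)⟩) ?_ ?_ ?_ ?_ ?_
  · rintro ⟨⟨a, b⟩, ⟨c, d⟩⟩ h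
    simp only [Finset.mem_sigma, Finset.HasAntidiagonal.mem_antidiagonal] at h ⊢
    obtain ⟨rfl, rfl⟩ := h
    exact ⟨by ring, trivial⟩
  · rintro ⟨⟨a, b⟩, ⟨c, d⟩⟩ h
    simp only [Finset.mem_sigma, Finset.HasAntidiagonal.mem_antidiagonal] at h ⊢
    obtain ⟨rfl, rfl⟩ := h
    exact ⟨by ring, trivial⟩
  all_goals
    rintro ⟨⟨a, b⟩, ⟨c, d⟩⟩ h
    obtain rfl : c + d = b := Finset.HasAntidiagonal.mem_antidiagonal.1 (Finset.mem_sigma.1 h).2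
    rfl

lemma map_runSum {R S : Type*} [CommSemiring R] [CommSemiring S] (g : R →+* S) (f : ℕ → R)
    (n : ℕ) : g (runSum f n) = runSum (fun i => g (f i)) n := by
  have h : (PowerSeries.mk fun i => g (f i)) = PowerSeries.map g (PowerSeries.mk f) := by
    ext; simp
  simp [runSum, h, ← map_pow]

lemma eval_ascPochhammer_sub (K M : ℕ) (h : M ≤ K) :
    Polynomial.eval ((K : ℝ) + 1 - M) (ascPochhammer ℝ M) = K.factorial / (K - M).factorial := by
  obtain ⟨j, rfl⟩ := Nat.exists_eq_add_of_le' h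
  have h1 : ((j + M : ℕ) : ℝ) + 1 - M = ((j + 1 : ℕ) : ℝ) := by push_cast; ring
  rw [h1, Nat.add_sub_cancel, eq_div_iff (by positivity), ← Nat.factorial_mul_ascFactorial j M,
    ← ascPochhammer_nat_eq_ascFactorial, ← ascPochhammer_eval_cast]
  push_cast
  ring

/-- The multiplicity function on `{0, …, r}` obtained from a partition of `r` by adjoining zeros
so that there are `K` parts in total. -/
def Nat.Partition.paddedCount {r : ℕ} (K : ℕ) (π : r.Partition) (l : ℕ) : ℕ :=
  if l = 0 then K - π.parts.card else π.parts.count l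

lemma Nat.Partition.le_of_mem {r : ℕ} (π : r.Partition) {l : ℕ} (h : l ∈ π.parts) : l ≤ r :=
  (Multiset.le_sum_of_mem h).trans_eq π.parts_sum

lemma Nat.Partition.card_parts_le {r : ℕ} (π : r.Partition) : π.parts.card ≤ r := by
  have h := Multiset.card_nsmul_le_sum (s := π.parts) (a := 1) fun x hx => π.parts_pos hx
  simpa [π.parts_sum] using h

lemma Nat.Partition.toFinset_subset {r : ℕ} (π : r.Partition) :
    π.parts.toFinset ⊆ Finset.Icc 1 r := fun _ hl =>
  Finset.mem_Icc.2 ⟨π.parts_pos (Multiset.mem_toFinset.1 hl),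
    π.le_of_mem (Multiset.mem_toFinset.1 hl)⟩

lemma Nat.Partition.sum_count {r : ℕ} (π : r.Partition) :
    ∑ l ∈ Finset.Icc 1 r, π.parts.count l = π.parts.card := by
  rw [← Multiset.toFinset_sum_count_eq]
  refine (Finset.sum_subset π.toFinset_subset fun l _ hl => ?_).symm
  simpa using hl

lemma Nat.Partition.sum_count_mul {r : ℕ} (π : r.Partition) :
    ∑ l ∈ Finset.Icc 1 r, π.parts.count l * l = r := by
  conv_rhs => rw [← π.parts_sum, Finset.sum_multiset_count]
  simp only [smul_eq_mul]
  refine (Finset.sum_subset π.toFinset_subset fun l _ hl => ?_).symm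
  have : π.parts.count l = 0 := by simpa using hl
  simp [this]

@[to_additive]
lemma Finset.prod_range_succ_eq_mul_prod_Icc {M : Type*} [CommMonoid M] (g : ℕ → M) (r : ℕ) :
    ∏ l ∈ Finset.range (r + 1), g l = g 0 * ∏ l ∈ Finset.Icc 1 r, g l := by
  rw [Finset.range_eq_Ico, Finset.prod_eq_prod_Ico_succ_bot (Nat.succ_pos r)]
  rfl

lemma coeff_sum_monomial_pow {R : Type*} [CommSemiring R] (f : ℕ → R) (r K : ℕ) :
    ((∑ l ∈ Finset.range (r + 1), Polynomial.monomial l (f l)) ^ K).coeff r =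
      ∑ k ∈ (Finset.piAntidiag (Finset.range (r + 1)) K).filter
          (fun k => ∑ l ∈ Finset.range (r + 1), k l * l = r),
        (Nat.multinomial (Finset.range (r + 1)) k : R) *
          ∏ l ∈ Finset.range (r + 1), f l ^ k l := by
  rw [Finset.sum_pow_eq_sum_piAntidiag, Polynomial.finsetSum_coeff, Finset.sum_filter]
  refine Finset.sum_congr rfl fun k _ => ?_
  have : ∏ l ∈ Finset.range (r + 1), Polynomial.monomial l (f l) ^ k l =
      Polynomial.monomial (∑ l ∈ Finset.range (r + 1), k l * l)
        (∏ l ∈ Finset.range (r + 1), f l ^ k l) := by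
    simp_rw [← Polynomial.C_mul_X_pow_eq_monomial, mul_pow, Finset.prod_mul_distrib, ← pow_mul,
      Finset.prod_pow_eq_pow_sum, ← Polynomial.C_pow, ← map_prod Polynomial.C, mul_comm (k _)]
  rw [this, Polynomial.coeff_natCast_mul, Polynomial.coeff_monomial, mul_ite, mul_zero]

lemma coeff_mk_pow_eq_coeff_sum_monomial_pow {R : Type*} [CommSemiring R] (f : ℕ → R) (r K : ℕ) :
    PowerSeries.coeff r (PowerSeries.mk f ^ K) =
      ((∑ l ∈ Finset.range (r + 1), Polynomial.monomial l (f l)) ^ K).coeff r := by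
  have h : PowerSeries.trunc (r + 1) (PowerSeries.mk f) =
      ∑ l ∈ Finset.range (r + 1), Polynomial.monomial l (f l) := by
    ext m
    simp [PowerSeries.coeff_trunc, Polynomial.finsetSum_coeff, Polynomial.coeff_monomial]
  have h2 := congrArg (fun p => Polynomial.coeff p r)
    (PowerSeries.trunc_trunc_pow (PowerSeries.mk f) (r + 1) K)
  simp only [PowerSeries.coeff_trunc, Nat.lt_succ_self, if_true] at h2
  rw [← h2, h, ← Polynomial.coe_pow, Polynomial.coeff_coe]

/-- The coefficients of a power of a power series with constant coefficient `1`, as a sum over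
partitions. -/
lemma coeff_mk_pow_eq_sum_partition (f : ℕ → ℝ) (hf : f 0 = 1) (r K : ℕ) :
    PowerSeries.coeff r (PowerSeries.mk f ^ K) =
      ∑ π : Nat.Partition r with π.parts.card ≤ K,
        (∏ l ∈ Finset.Icc 1 r, f l ^ π.parts.count l) *
          Polynomial.eval ((K : ℝ) + 1 - π.parts.card) (ascPochhammer ℝ π.parts.card) /
          ∏ l ∈ Finset.Icc 1 r, ((π.parts.count l).factorial : ℝ) := by
  rw [coeff_mk_pow_eq_coeff_sum_monomial_pow, coeff_sum_monomial_pow]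
  symm
  refine Finset.sum_bij (fun π _ => π.paddedCount K) ?_ ?_ ?_ ?_
  · intro π hπ
    have hπ : π.parts.card ≤ K := by simpa using hπ
    have hc : ∀ l ∈ Finset.Icc 1 r, π.paddedCount K l = π.parts.count l := fun l hl => by
      simp [Nat.Partition.paddedCount, Nat.one_le_iff_ne_zero.1 (Finset.mem_Icc.1 hl).1]
    simp only [Finset.mem_filter, Finset.mem_piAntidiag, Finset.sum_range_succ_eq_add_sum_Icc]
    have hc' : ∀ l ∈ Finset.Icc 1 r, π.paddedCount K l * l = π.parts.count l * l :=
      fun l hl => by rw [hc l hl]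
    rw [Finset.sum_congr rfl hc, Finset.sum_congr rfl hc', π.sum_count, π.sum_count_mul]
    refine ⟨⟨by simp [Nat.Partition.paddedCount, hπ], fun l hl => ?_⟩, by simp⟩
    by_cases h0 : l = 0
    · simp [h0]
    · simp only [Nat.Partition.paddedCount, h0, if_false, ne_eq, Multiset.count_eq_zero,
        not_not] at hl
      exact Finset.mem_range_succ_iff.2 (π.le_of_mem hl)
  · intro π _ π' _ h
    refine Nat.Partition.ext (Multiset.ext.2 fun l => ?_)
    by_cases h0 : l = 0
    · have key : ∀ ρ : r.Partition, ρ.parts.count 0 = 0 := fun ρ =>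
        Multiset.count_eq_zero.2 fun hm => (ρ.parts_pos hm).false
      rw [h0, key, key]
    · simpa [Nat.Partition.paddedCount, h0] using congrFun h l
  · intro k hk
    simp only [Finset.mem_filter, Finset.mem_piAntidiag,
      Finset.sum_range_succ_eq_add_sum_Icc] at hk
    obtain ⟨⟨hK, hsupp⟩, hr⟩ := hk
    have hcard : (∑ l ∈ Finset.Icc 1 r, Multiset.replicate (k l) l).card =
        ∑ l ∈ Finset.Icc 1 r, k l := by simp
    refine ⟨⟨∑ l ∈ Finset.Icc 1 r, Multiset.replicate (k l) l, ?_, ?_⟩, ?_, ?_⟩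
    · intro i hi
      obtain ⟨l, hl, hil⟩ := Multiset.mem_sum.1 hi
      rw [Multiset.eq_of_mem_replicate hil]
      exact (Finset.mem_Icc.1 hl).1
    · rw [Multiset.sum_sum]
      simpa using hr
    · simp only [Finset.mem_filter, Finset.mem_univ, true_and, hcard]
      omega
    · funext l
      simp only [Nat.Partition.paddedCount, hcard]
      split_ifs with h0
      · subst h0; omega
      · rw [Multiset.count_sum']
        simp only [Multiset.count_replicate, Finset.sum_ite_eq', Finset.mem_Icc]
        split_ifs with hl
        · rfl
        · by_contra hne
          have := Finset.mem_range.1 (hsupp l (Ne.symm hne))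
          omega
  · intro π hπ
    have hπ : π.parts.card ≤ K := by simpa using hπ
    have hc : ∀ l ∈ Finset.Icc 1 r, π.paddedCount K l = π.parts.count l := fun l hl => by
      simp [Nat.Partition.paddedCount, Nat.one_le_iff_ne_zero.1 (Finset.mem_Icc.1 hl).1]
    have h0 : π.paddedCount K 0 = K - π.parts.card := by simp [Nat.Partition.paddedCount]
    have hm := Nat.multinomial_spec (Finset.range (r + 1)) (π.paddedCount K)
    rw [Finset.sum_range_succ_eq_add_sum_Icc, Finset.prod_range_succ_eq_mul_prod_Icc,
      Finset.sum_congr rfl hc, Finset.prod_congr rfl fun l hl => by rw [hc l hl], π.sum_count, h0,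
      Nat.sub_add_cancel hπ] at hm
    have hcf : ∀ l ∈ Finset.Icc 1 r, f l ^ π.paddedCount K l = f l ^ π.parts.count l :=
      fun l hl => by rw [hc l hl]
    rw [eval_ascPochhammer_sub K _ hπ, Finset.prod_range_succ_eq_mul_prod_Icc,
      Finset.prod_congr rfl hcf, hf, one_pow, one_mul, ← hm]
    have hpos : (∏ l ∈ Finset.Icc 1 r, ((π.parts.count l).factorial : ℝ)) ≠ 0 :=
      Finset.prod_ne_zero_iff.2 fun l _ => by positivity
    have hpos' : ((K - π.parts.card).factorial : ℝ) ≠ 0 := by positivity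
    push_cast
    field_simp

lemma runSum_eq_one_add_sum (f : ℕ → ℝ) (hf : f 0 = 1) (N : ℕ) :
    runSum f (N + 1) = 1 + ∑ r ∈ Finset.Icc 1 N, ∑ M ∈ Finset.Icc 1 (min r (N - r + 1)),
      ∑ π ∈ Finset.univ.filter (fun π : Nat.Partition r => Multiset.card π.parts = M),
        (∏ l ∈ Finset.Icc 1 r, f l ^ (π.parts.count l))
          * Polynomial.eval ((N : ℝ) - r + 2 - M) (ascPochhammer ℝ M)
          / ∏ l ∈ Finset.Icc 1 r, (Nat.factorial (π.parts.count l) : ℝ) := by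
  rw [runSum, Finset.Nat.sum_antidiagonal_succ]
  rw [← Finset.Nat.sum_antidiagonal_swap]
  simp only [Prod.fst_swap, Prod.snd_swap]
  rw [Finset.Nat.sum_antidiagonal_eq_sum_range_succ
    (fun r K => PowerSeries.coeff r (PowerSeries.mk f ^ (K + 1))),
    Finset.sum_range_succ_eq_add_sum_Icc]
  simp only [pow_zero, PowerSeries.coeff_one, Nat.succ_ne_zero, if_false, zero_add]
  congr 1
  · simp [hf]
  refine Finset.sum_congr rfl fun r hr => ?_
  obtain ⟨hr1, hrN⟩ := Finset.mem_Icc.1 hr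
  rw [coeff_mk_pow_eq_sum_partition f hf]
  have hmaps : ∀ π ∈ Finset.univ.filter (fun π : r.Partition => π.parts.card ≤ N - r + 1),
      π.parts.card ∈ Finset.Icc 1 (min r (N - r + 1)) := fun π hπ => by
    have h1 : π.parts.card ≠ 0 := fun h => by
      have := π.parts_sum
      rw [Multiset.card_eq_zero.1 h] at this
      simp at this
      omega
    simp only [Finset.mem_Icc, le_min_iff]
    exact ⟨Nat.one_le_iff_ne_zero.2 h1, π.card_parts_le, by simpa using hπ⟩
  rw [← Finset.sum_fiberwise_of_maps_to hmaps]
  refine Finset.sum_congr rfl fun M hM => ?_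
  rw [Finset.filter_filter]
  refine Finset.sum_congr ?_ fun π hπ => ?_
  · ext π
    have := (le_min_iff.1 (Finset.mem_Icc.1 hM).2).2
    simp only [Finset.mem_filter, Finset.mem_univ, true_and]
    omega
  · have hM' : π.parts.card = M := by simpa using hπ
    rw [hM', Nat.cast_add, Nat.cast_sub hrN]
    congr 4
    push_cast
    ring

/-- Every set of consecutive positive coordinates of `x` has sum of squares below `t`, even after
adding `s` if the set is an initial segment (possibly empty). -/
def BlocksBelow {n : ℕ} (t s : ℝ) (x : Fin n → ℝ) : Prop :=
  (∀ B : Finset (Fin n), (∀ i ∈ B, 0 < x i) → (∀ i ∈ B, ∀ j, j ≤ i → j ∈ B) →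
    s + ∑ i ∈ B, x i ^ 2 < t) ∧
  ∀ B : Finset (Fin n), (∀ i ∈ B, 0 < x i) → (∀ i ∈ B, ∀ j ∈ B, ∀ k, i ≤ k → k ≤ j → k ∈ B) →
    ∑ i ∈ B, x i ^ 2 < t

lemma exists_isSuccessRun_superset {n : ℕ} (succ : Fin n → Prop) (B : Finset (Fin n))
    (hne : B.Nonempty) (hsucc : ∀ i ∈ B, succ i)
    (hconv : ∀ i ∈ B, ∀ j ∈ B, ∀ k, i ≤ k → k ≤ j → k ∈ B) :
    ∃ A, IsSuccessRun succ A ∧ B ⊆ A := by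
  classical
  obtain ⟨b, hb⟩ := hne
  refine ⟨Finset.univ.filter fun k => ∀ j, (b ≤ j ∧ j ≤ k ∨ k ≤ j ∧ j ≤ b) → succ j,
    ⟨⟨b, ?_⟩, ?_, ?_, ?_⟩, ?_⟩
  · simp only [Finset.mem_filter, Finset.mem_univ, true_and]
    intro j hj
    obtain rfl : j = b := by omega
    exact hsucc j hb
  · intro i hi
    exact (Finset.mem_filter.1 hi).2 i (by omega)
  · intro i hi j hj k hik hkj
    simp only [Finset.mem_filter, Finset.mem_univ, true_and] at hi hj ⊢
    intro m hm
    rcases hm with hm | hm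
    · exact hj m (by omega)
    · exact hi m (by omega)
  · rintro i hi ⟨j, hj, hij⟩
    simp only [Finset.mem_filter, Finset.mem_univ, true_and] at hj ⊢
    intro m hm
    by_cases hmi : m = i
    · exact hmi ▸ hi
    · exact hj m (by omega)
  · intro k hk
    simp only [Finset.mem_filter, Finset.mem_univ, true_and]
    rintro j (⟨h1, h2⟩ | ⟨h1, h2⟩)
    · exact hsucc j (hconv b hb k hk j h1 h2)
    · exact hsucc j (hconv k hk b hb j h1 h2)

lemma forall_isSuccessRun_iff_blocksBelow {n : ℕ} {t : ℝ} (ht : 0 < t) (x : Fin n → ℝ) :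
    (∀ A, IsSuccessRun (fun i => 0 < x i) A → ∑ i ∈ A, x i ^ 2 < t) ↔ BlocksBelow t 0 x := by
  constructor
  · intro h
    have key : ∀ B : Finset (Fin n), (∀ i ∈ B, 0 < x i) →
        (∀ i ∈ B, ∀ j ∈ B, ∀ k, i ≤ k → k ≤ j → k ∈ B) → ∑ i ∈ B, x i ^ 2 < t := by
      intro B hB hconv
      rcases B.eq_empty_or_nonempty with rfl | hne
      · simpa using ht
      obtain ⟨A, hA, hBA⟩ := exists_isSuccessRun_superset _ B hne hB hconv
      exact (Finset.sum_le_sum_of_subset_of_nonneg hBA fun _ _ _ => sq_nonneg _).trans_lt (h A hA)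
    refine ⟨fun B hB hlow => ?_, key⟩
    rw [zero_add]
    exact key B hB fun _ _ j hj k _ hkj => hlow j hj k hkj
  · exact fun h A hA => h.2 A hA.2.1 hA.2.2.1

lemma Finset.sum_fin_succ_eq {n : ℕ} (g : Fin (n + 1) → ℝ) (B : Finset (Fin (n + 1))) :
    ∑ i ∈ B, g i = (if 0 ∈ B then g 0 else 0) +
      ∑ i ∈ Finset.univ.filter (fun i : Fin n => i.succ ∈ B), g i.succ := by
  rw [Finset.sum_filter, ← Fin.sum_univ_succ (fun i => if i ∈ B then g i else 0),
    ← Finset.sum_filter]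
  simp

lemma BlocksBelow.tail {n : ℕ} {t s : ℝ} {x : Fin (n + 1) → ℝ} (h : BlocksBelow t s x)
    (B : Finset (Fin n)) (hB : ∀ i ∈ B, 0 < x i.succ)
    (hconv : ∀ i ∈ B, ∀ j ∈ B, ∀ k, i ≤ k → k ≤ j → k ∈ B) :
    ∑ i ∈ B, x i.succ ^ 2 < t := by
  have := h.2 (B.map (Fin.succEmb n)) (by simpa using hB) (by
    simp only [Finset.mem_map, Fin.coe_succEmb, forall_exists_index, and_imp,
      forall_apply_eq_imp_iff₂]
    intro i hi j hj k hik hkj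
    obtain ⟨k, rfl⟩ := Fin.eq_succ_of_ne_zero (i := k) (by
      rintro rfl
      exact absurd hik (by simp))
    exact ⟨k, hconv i hi j hj k (by simpa using hik) (by simpa using hkj), rfl⟩)
  simpa using this

lemma blocksBelow_succ_of_nonpos {n : ℕ} {t s : ℝ} {x : Fin (n + 1) → ℝ} (hx : x 0 ≤ 0) :
    BlocksBelow t s x ↔ s < t ∧ BlocksBelow t 0 (fun i : Fin n => x i.succ) := by
  constructor
  · intro h
    refine ⟨by simpa using h.1 ∅, fun B hB hlow => ?_, h.tail⟩
    rw [zero_add]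
    exact h.tail B hB fun _ _ j hj k _ hkj => hlow j hj k hkj
  · rintro ⟨hst, h⟩
    have h0 : ∀ B : Finset (Fin (n + 1)), (∀ i ∈ B, 0 < x i) → 0 ∉ B :=
      fun B hB hmem => (hB 0 hmem).not_ge hx
    constructor
    · intro B hB hlow
      rcases B.eq_empty_or_nonempty with rfl | ⟨i, hi⟩
      · simpa using hst
      · exact absurd (hlow i hi 0 (Fin.zero_le i)) (h0 B hB)
    · intro B hB hconv
      rw [Finset.sum_fin_succ_eq, if_neg (h0 B hB), zero_add]
      refine h.2 _ (fun i hi => hB _ (by simpa using hi)) fun i hi j hj k hik hkj => ?_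
      simp only [Finset.mem_filter, Finset.mem_univ, true_and] at hi hj ⊢
      exact hconv _ hi _ hj _ (by simpa using hik) (by simpa using hkj)

lemma blocksBelow_succ_of_pos {n : ℕ} {t s : ℝ} (hs : 0 ≤ s) {x : Fin (n + 1) → ℝ}
    (hx : 0 < x 0) :
    BlocksBelow t s x ↔ BlocksBelow t (s + x 0 ^ 2) (fun i : Fin n => x i.succ) := by
  constructor
  · intro h
    refine ⟨fun B hB hlow => ?_, h.tail⟩
    have := h.1 (insert 0 (B.map (Fin.succEmb n))) (by simpa [hx] using hB) (by
      intro i hi j hji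
      refine Fin.cases (fun _ => by simp) (fun j hji => ?_) j hji
      simp only [Finset.mem_insert, Finset.mem_map, Fin.coe_succEmb, Fin.succ_ne_zero,
        false_or] at hi ⊢
      rcases hi with rfl | ⟨i, hi, rfl⟩
      · exact absurd hji (by simp)
      · exact ⟨j, hlow i hi j (by simpa using hji), rfl⟩)
    rw [Finset.sum_insert (by simp)] at this
    simpa [add_assoc] using this
  · intro h
    have hlow' : ∀ B : Finset (Fin (n + 1)), (∀ i ∈ B, 0 < x i) →
        (∀ i ∈ B, ∀ j, j ≤ i → j ∈ B) → s + ∑ i ∈ B, x i ^ 2 < t := by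
      intro B hB hlow
      have h1 := h.1 (Finset.univ.filter fun i : Fin n => i.succ ∈ B)
        (fun i hi => hB _ (by simpa using hi)) (by
          intro i hi j hj
          simp only [Finset.mem_filter, Finset.mem_univ, true_and] at hi ⊢
          exact hlow _ hi _ (by simpa using hj))
      rw [Finset.sum_fin_succ_eq]
      split_ifs
      · linarith
      · linarith [sq_nonneg (x 0)]
    refine ⟨hlow', fun B hB hconv => ?_⟩
    by_cases h0 : 0 ∈ B
    · have := hlow' B hB fun i hi j hj => hconv 0 h0 i hi j (Fin.zero_le j) hj
      linarith
    · rw [Finset.sum_fin_succ_eq, if_neg h0, zero_add]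
      refine h.2 _ (fun i hi => hB _ (by simpa using hi)) fun i hi j hj k hik hkj => ?_
      simp only [Finset.mem_filter, Finset.mem_univ, true_and] at hi hj ⊢
      exact hconv _ hi _ hj _ (by simpa using hik) (by simpa using hkj)

lemma measurableSet_blocksBelow (n : ℕ) (t s : ℝ) :
    MeasurableSet {x : Fin n → ℝ | BlocksBelow t s x} := by
  have hpos : ∀ B : Finset (Fin n), MeasurableSet {x : Fin n → ℝ | ∀ i ∈ B, 0 < x i} := fun B => by
    simp only [Set.ofPred_forall]
    exact MeasurableSet.iInter fun i => MeasurableSet.iInter fun _ =>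
      measurableSet_lt measurable_const (measurable_pi_apply i)
  have hsum : ∀ (c : ℝ) (B : Finset (Fin n)),
      MeasurableSet {x : Fin n → ℝ | c + ∑ i ∈ B, x i ^ 2 < t} := fun c B =>
    measurableSet_lt (by fun_prop) measurable_const
  simp only [BlocksBelow, Set.ofPred_and, Set.ofPred_forall]
  refine MeasurableSet.inter (MeasurableSet.iInter fun B => ?_) (MeasurableSet.iInter fun B => ?_)
  · exact (hpos B).imp ((MeasurableSet.const _).imp (hsum s B))
  · exact (hpos B).imp ((MeasurableSet.const _).imp (by simpa only [zero_add] using hsum 0 B))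

/-- The standard Gaussian measure on `ℝⁿ`. -/
noncomputable abbrev stdGaussianPi (n : ℕ) : Measure (Fin n → ℝ) :=
  Measure.pi fun _ => gaussianReal 0 1

/-- The probability that the sum of squares of `n` independent standard normal variables is
below `u`. -/
noncomputable def sumSqProb (n : ℕ) (u : ℝ) : ENNReal :=
  stdGaussianPi n {x | ∑ i, x i ^ 2 < u}

lemma stdGaussianPi_succ_apply {n : ℕ} {S : Set (Fin (n + 1) → ℝ)} (hS : MeasurableSet S) :
    stdGaussianPi (n + 1) S =
      ∫⁻ y, stdGaussianPi n {z | (Fin.cons y z : Fin (n + 1) → ℝ) ∈ S} ∂gaussianReal 0 1 := by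
  have h := (measurePreserving_piFinSuccAbove
    (fun _ : Fin (n + 1) => gaussianReal 0 1) 0).symm.measure_preimage hS.nullMeasurableSet
  rw [← h, Measure.prod_apply (MeasurableEquiv.measurable _ hS)]
  refine lintegral_congr fun y => congrArg _ (Set.ext fun z => ?_)
  simp [MeasurableEquiv.piFinSuccAbove_symm_apply, Fin.insertNthEquiv, Fin.insertNth_zero']

lemma sumSqProb_mono (n : ℕ) : Monotone (sumSqProb n) := fun _ _ h =>
  measure_mono fun _ hx => lt_of_lt_of_le hx h

lemma sumSqProb_succ (n : ℕ) (u : ℝ) :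
    sumSqProb (n + 1) u = ∫⁻ y, sumSqProb n (u - y ^ 2) ∂gaussianReal 0 1 := by
  rw [sumSqProb, stdGaussianPi_succ_apply (measurableSet_lt (by fun_prop) measurable_const)]
  refine lintegral_congr fun y => ?_
  simp only [sumSqProb, Set.mem_ofPred_eq, Fin.sum_univ_succ, Fin.cons_zero, Fin.cons_succ,
    lt_sub_iff_add_lt']

lemma sumSqProb_zero (u : ℝ) : sumSqProb 0 u = if 0 < u then 1 else 0 := by
  split_ifs with h <;> simp [sumSqProb, h]

lemma lintegral_gaussianReal_of_even {h : ℝ → ENNReal} (hm : Measurable h)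
    (heven : ∀ y, h (-y) = h y) :
    ∫⁻ y, h y ∂gaussianReal 0 1 = 2 * ∫⁻ y in Set.Ioi 0, h y ∂gaussianReal 0 1 := by
  have : NullSingletonClass (gaussianReal 0 1) := nullSingletonClass_gaussianReal one_ne_zero
  have hneg : MeasurePreserving (fun y : ℝ => -y) (gaussianReal 0 1) (gaussianReal 0 1) :=
    ⟨measurable_neg, by simpa using gaussianReal_map_neg (μ := 0) (v := 1)⟩
  have h2 : ∫⁻ y in Set.Iio 0, h y ∂gaussianReal 0 1 = ∫⁻ y in Set.Ioi 0, h y ∂gaussianReal 0 1 := by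
    rw [← hneg.setLIntegral_comp_preimage measurableSet_Iio hm]
    simp [heven]
  rw [← lintegral_add_compl h (measurableSet_Ioi (a := 0)), Set.compl_Ioi,
    setLIntegral_congr Iio_ae_eq_Iic.symm, h2, two_mul]

lemma gaussianReal_Ioi_zero : gaussianReal 0 1 (Set.Ioi 0) = 2⁻¹ := by
  have h := lintegral_gaussianReal_of_even (h := fun _ => 1) measurable_const fun _ => rfl
  simp only [lintegral_const, measure_univ, Measure.restrict_apply, MeasurableSet.univ,
    Set.univ_inter, one_mul, mul_one] at h
  exact ENNReal.eq_inv_of_mul_eq_one_left (by rw [mul_comm]; exact h.symm)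

lemma gaussianReal_Iic_zero : gaussianReal 0 1 (Set.Iic 0) = 2⁻¹ := by
  rw [← Set.compl_Ioi, prob_compl_eq_one_sub measurableSet_Ioi, gaussianReal_Ioi_zero,
    ENNReal.one_sub_inv_two]

lemma two_pow_mul_measure_blocksBelow {t : ℝ} (ht : 0 < t) (n : ℕ) :
    ∀ s, 0 ≤ s → 2 ^ n * stdGaussianPi n {x | BlocksBelow t s x} =
      ∑ p ∈ antidiagonal n, sumSqProb p.1 (t - s) * runSum (fun a => sumSqProb a t) p.2 := by
  induction n with
  | zero =>
    intro s hs
    have h : ∀ x : Fin 0 → ℝ, BlocksBelow t s x ↔ s < t := fun x => by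
      have hB : ∀ B : Finset (Fin 0), ∑ i ∈ B, x i ^ 2 = 0 := fun B => by
        simp [Finset.eq_empty_of_isEmpty B]
      simp [BlocksBelow, hB, ht]
    by_cases hst : s < t <;> simp [h, hst, runSum_zero, sumSqProb_zero]
  | succ n ih =>
    intro s hs
    have h0 : 2 ^ n * stdGaussianPi n {x | BlocksBelow t 0 x} =
        runSum (fun a => sumSqProb a t) (n + 1) := by
      rw [ih 0 le_rfl, sub_zero, runSum_succ]
    have hmeas : ∀ p : ℕ × ℕ, Measurable fun y : ℝ => sumSqProb p.1 (t - (s + y ^ 2)) := fun p =>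
      (sumSqProb_mono p.1).measurable.comp (by fun_prop)
    have hpos : ∫⁻ y in Set.Ioi 0, stdGaussianPi n
          {z | BlocksBelow t s (Fin.cons y z : Fin (n + 1) → ℝ)} ∂gaussianReal 0 1 =
        ∫⁻ y in Set.Ioi 0, stdGaussianPi n {z | BlocksBelow t (s + y ^ 2) z} ∂gaussianReal 0 1 :=
      setLIntegral_congr_fun measurableSet_Ioi fun y hy => by
        refine congrArg _ (Set.ext fun z => ?_)
        have h := blocksBelow_succ_of_pos (t := t) hs (x := (Fin.cons y z : Fin (n + 1) → ℝ)) hy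
        simp only [Fin.cons_zero, Fin.cons_succ] at h
        exact h
    have hneg : ∫⁻ y in Set.Iic 0, stdGaussianPi n
          {z | BlocksBelow t s (Fin.cons y z : Fin (n + 1) → ℝ)} ∂gaussianReal 0 1 =
        2⁻¹ * (sumSqProb 0 (t - s) * stdGaussianPi n {z | BlocksBelow t 0 z}) := by
      rw [setLIntegral_congr_fun (g := fun _ =>
        sumSqProb 0 (t - s) * stdGaussianPi n {z | BlocksBelow t 0 z}) measurableSet_Iic]
      · simp [gaussianReal_Iic_zero, mul_comm]
      · intro y hy
        have h : ∀ z : Fin n → ℝ, BlocksBelow t s (Fin.cons y z : Fin (n + 1) → ℝ) ↔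
            s < t ∧ BlocksBelow t 0 z := fun z => by
          have h := blocksBelow_succ_of_nonpos (t := t) (s := s)
            (x := (Fin.cons y z : Fin (n + 1) → ℝ)) hy
          simpa only [Fin.cons_succ] using h
        by_cases hst : s < t <;> simp [h, sumSqProb_zero, hst]
    have hsum : 2 ^ (n + 1) * ∫⁻ y in Set.Ioi 0, stdGaussianPi n
          {z | BlocksBelow t (s + y ^ 2) z} ∂gaussianReal 0 1 =
        ∑ p ∈ antidiagonal n,
          sumSqProb (p.1 + 1) (t - s) * runSum (fun a => sumSqProb a t) p.2 := by
      rw [pow_succ', mul_assoc, ← lintegral_const_mul' _ _ (by simp)]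
      simp_rw [ih _ (add_nonneg hs (sq_nonneg _))]
      rw [lintegral_finsetSum _ fun p _ => (hmeas p).mul_const _, Finset.mul_sum]
      refine Finset.sum_congr rfl fun p _ => ?_
      rw [lintegral_mul_const _ (hmeas p), ← mul_assoc,
        ← lintegral_gaussianReal_of_even (hmeas p) (by simp), sumSqProb_succ]
      simp only [sub_sub]
    rw [stdGaussianPi_succ_apply (measurableSet_blocksBelow _ _ _),
      ← lintegral_add_compl _ (measurableSet_Ioi (a := (0 : ℝ))), Set.compl_Ioi]
    simp only [Set.mem_ofPred_eq]
    rw [hpos, hneg, mul_add, hsum, Finset.Nat.sum_antidiagonal_succ, ← h0, add_comm]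
    congr 1
    rw [pow_succ, mul_assoc, ← mul_assoc 2, ENNReal.mul_inv_cancel (by simp) (by simp), one_mul]
    ring

lemma two_pow_mul_measure_blocksBelow_zero {t : ℝ} (ht : 0 < t) (n : ℕ) :
    2 ^ n * stdGaussianPi n {x | BlocksBelow t 0 x} =
      runSum (fun a => sumSqProb a t) (n + 1) := by
  rw [two_pow_mul_measure_blocksBelow ht n 0 le_rfl, sub_zero, runSum_succ]

lemma stdGaussianPi_forall_nonpos (n : ℕ) :
    stdGaussianPi n {x | ∀ i, x i ≤ 0} = (2 ^ n)⁻¹ := by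
  have h : {x : Fin n → ℝ | ∀ i, x i ≤ 0} = Set.univ.pi fun _ => Set.Iic 0 := by
    ext; simp only [Set.mem_ofPred_eq, Set.mem_univ_pi, Set.mem_Iic]
  rw [h, Measure.pi_pi]
  simp [gaussianReal_Iic_zero, ENNReal.inv_pow]

lemma stdGaussianPi_eq_withDensity (n : ℕ) :
    stdGaussianPi n = (volume : Measure (Fin n → ℝ)).withDensity
      fun x => ENNReal.ofReal ((√(2 * Real.pi))⁻¹ ^ n * Real.exp (-(∑ i, x i ^ 2) / 2)) := by
  have hpdf : ∀ x : Fin n → ℝ, (√(2 * Real.pi))⁻¹ ^ n * Real.exp (-(∑ i, x i ^ 2) / 2) =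
      ∏ i, gaussianPDFReal 0 1 (x i) := fun x => by
    simp [gaussianPDFReal, Finset.prod_mul_distrib, ← Real.exp_sum, ← Finset.sum_div]
  simp_rw [hpdf]
  refine Measure.pi_eq fun s hs => ?_
  have hind : ∀ x : Fin n → ℝ, (Set.univ.pi s).indicator
      (fun x => ∏ i, gaussianPDFReal 0 1 (x i)) x =
        ∏ i, (s i).indicator (gaussianPDFReal 0 1) (x i) := fun x => by
    by_cases hx : x ∈ Set.univ.pi s
    · rw [Set.indicator_of_mem hx]
      exact Finset.prod_congr rfl fun i _ => (Set.indicator_of_mem (hx i trivial) _).symm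
    · rw [Set.indicator_of_notMem hx]
      obtain ⟨i, hi⟩ : ∃ i, x i ∉ s i := by simpa [Set.mem_pi] using hx
      exact (Finset.prod_eq_zero (Finset.mem_univ i) (Set.indicator_of_notMem hi _)).symm
  have hint : Integrable fun x : Fin n → ℝ => ∏ i, gaussianPDFReal 0 1 (x i) :=
    Integrable.fintype_prod fun _ => integrable_gaussianPDFReal 0 1
  rw [withDensity_apply _ (MeasurableSet.univ_pi hs), ← ofReal_integral_eq_lintegral_ofReal
    hint.integrableOn (.of_forall fun x => Finset.prod_nonneg fun i _ => gaussianPDFReal_nonneg _ _ _),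
    ← integral_indicator (MeasurableSet.univ_pi hs)]
  simp_rw [hind]
  rw [integral_fintype_prod_volume_eq_prod (fun i => (s i).indicator (gaussianPDFReal 0 1)),
    ENNReal.ofReal_prod_of_nonneg fun i _ => integral_nonneg fun x =>
      Set.indicator_nonneg (fun y _ => gaussianPDFReal_nonneg 0 1 y) x]
  refine Finset.prod_congr rfl fun i _ => ?_
  rw [integral_indicator (hs i), gaussianReal_apply_eq_integral 0 one_ne_zero]

lemma toReal_sumSqProb_eq_integral (n : ℕ) (u : ℝ) :
    (sumSqProb n u).toReal = ∫ x : EuclideanSpace ℝ (Fin n),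
      (Set.Iio u).indicator (fun v => (√(2 * Real.pi))⁻¹ ^ n * Real.exp (-v / 2)) (‖x‖ ^ 2) := by
  have hS : MeasurableSet {x : Fin n → ℝ | ∑ i, x i ^ 2 < u} :=
    measurableSet_lt (by fun_prop) measurable_const
  rw [sumSqProb, stdGaussianPi_eq_withDensity, withDensity_apply _ hS,
    ← integral_eq_lintegral_of_nonneg_ae (.of_forall fun x => by positivity)
      (Continuous.aestronglyMeasurable (by fun_prop)), ← integral_indicator hS,
    ← (PiLp.volume_preserving_ofLp (Fin n)).integral_comp
      (MeasurableEquiv.toLp 2 (Fin n → ℝ)).symm.measurableEmbedding]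
  refine integral_congr_ae (.of_forall fun x => ?_)
  have hx : ‖x‖ ^ 2 = ∑ i, x.ofLp i ^ 2 := by
    rw [EuclideanSpace.norm_sq_eq]
    simp
  simp only [hx]
  rfl

lemma integral_radial_eq (n : ℕ) (u : ℝ) :
    ∫ y in Set.Ioi (0 : ℝ), y ^ n * (Set.Iio u).indicator (fun v => Real.exp (-v / 2)) (y ^ 2) =
      2 ^ (((n + 1 : ℕ) : ℝ) / 2 - 1) * ∫ s in Set.Ioi (0 : ℝ), (Set.Iio (u / 2)).indicator
        (fun s => s ^ (((n + 1 : ℕ) : ℝ) / 2 - 1) * Real.exp (-s)) s := by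
  set G : ℝ → ℝ := (Set.Iio (u / 2)).indicator
    (fun s => s ^ (((n + 1 : ℕ) : ℝ) / 2 - 1) * Real.exp (-s)) with hG
  have h1 := integral_comp_mul_left_Ioi G 0 (b := (1 / 2 : ℝ)) (by norm_num)
  have h2 := integral_comp_rpow_Ioi_of_pos (g := fun v => G (1 / 2 * v)) (p := 2) (by norm_num)
  rw [mul_zero] at h1
  have h3 : ∫ s in Set.Ioi (0 : ℝ), G s =
      2⁻¹ * ∫ x in Set.Ioi (0 : ℝ), (2 * x ^ ((2 : ℝ) - 1)) • G (1 / 2 * x ^ (2 : ℝ)) := by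
    rw [h2, h1]
    simp
  rw [h3, ← mul_assoc, ← integral_const_mul]
  refine setIntegral_congr_fun measurableSet_Ioi fun y hy => ?_
  have hy : 0 < y := hy
  have e1 : y ^ ((2 : ℝ) - 1) = y := by norm_num
  simp only [smul_eq_mul, e1, hG, Set.indicator_apply, Set.mem_Iio, Real.rpow_ofNat]
  have hiff : 1 / 2 * y ^ 2 < u / 2 ↔ y ^ 2 < u := by constructor <;> intro h <;> linarith
  simp only [hiff]
  split_ifs
  · have e2 : (1 / 2 * y ^ 2) ^ (((n + 1 : ℕ) : ℝ) / 2 - 1) =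
        (2 ^ (((n + 1 : ℕ) : ℝ) / 2 - 1))⁻¹ * (y ^ n / y) := by
      rw [Real.mul_rpow (by norm_num) (by positivity), ← Real.rpow_natCast y 2,
        ← Real.rpow_mul hy.le, one_div, Real.inv_rpow (by norm_num), ← Real.rpow_natCast y n,
        ← Real.rpow_sub_one hy.ne']
      congr 2
      push_cast
      ring
    have e3 : -(1 / 2 * y ^ 2) = -y ^ 2 / 2 := by ring
    rw [e2, e3]
    have : (2 : ℝ) ^ (((n + 1 : ℕ) : ℝ) / 2 - 1) ≠ 0 := by positivity
    field_simp
  · simp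

lemma sumSqProb_eq_chiSqCDF {n : ℕ} (hn : 1 ≤ n) {u : ℝ} (hu : 0 < u) :
    (sumSqProb n u).toReal = chiSqCDF n u := by
  obtain ⟨m, rfl⟩ := Nat.exists_eq_add_of_le' hn
  have hvol : (volume : Measure (EuclideanSpace ℝ (Fin (m + 1)))).real (Metric.ball 0 1) =
      √Real.pi ^ (m + 1) / Real.Gamma (((m + 1 : ℕ) : ℝ) / 2 + 1) := by
    rw [Measure.real, EuclideanSpace.volume_ball]
    simp only [ENNReal.ofReal_one, one_pow, one_mul, Fintype.card_fin]
    exact ENNReal.toReal_ofReal (by positivity)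
  have hrad : ∀ y : ℝ, (Set.Iio u).indicator
      (fun v => (√(2 * Real.pi))⁻¹ ^ (m + 1) * Real.exp (-v / 2)) (y ^ 2) =
      (√(2 * Real.pi))⁻¹ ^ (m + 1) * (Set.Iio u).indicator (fun v => Real.exp (-v / 2)) (y ^ 2) :=
    fun y => by simp [Set.indicator_apply]
  rw [toReal_sumSqProb_eq_integral]
  rw [integral_fun_norm_addHaar volume (fun y => (Set.Iio u).indicator
    (fun v => (√(2 * Real.pi))⁻¹ ^ (m + 1) * Real.exp (-v / 2)) (y ^ 2)), hvol]
  simp only [hrad, smul_eq_mul, finrank_euclideanSpace, Fintype.card_fin, Nat.add_sub_cancel,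
    mul_left_comm _ ((√(2 * Real.pi))⁻¹ ^ (m + 1))]
  rw [integral_const_mul, integral_radial_eq, chiSqCDF,
    intervalIntegral.integral_of_le (by positivity), integral_Ioc_eq_integral_Ioo,
    setIntegral_indicator measurableSet_Iio, Set.Ioi_inter_Iio, nsmul_eq_mul,
    Real.Gamma_add_one (by positivity)]
  have hg : Real.Gamma (((m + 1 : ℕ) : ℝ) / 2) ≠ 0 := (Real.Gamma_pos_of_pos (by positivity)).ne'
  have h2 : (2 : ℝ) ^ (((m + 1 : ℕ) : ℝ) / 2 - 1) = √2 ^ (m + 1) / 2 := by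
    rw [Real.rpow_sub_one two_ne_zero, Real.sqrt_eq_rpow, ← Real.rpow_natCast,
      ← Real.rpow_mul zero_le_two]
    ring_nf
  have hpi : √Real.pi ≠ 0 := (Real.sqrt_pos.2 Real.pi_pos).ne'
  rw [h2, Real.sqrt_mul zero_le_two, inv_pow, mul_pow]
  have hm : ((m + 1 : ℕ) : ℝ) ≠ 0 := by positivity
  have h2' : √(2 : ℝ) ≠ 0 := by positivity
  field_simp

lemma gaussianReal_map_standardize (m : ℝ) {s : ℝ} (hs : 0 < s) {v : NNReal}
    (hv : (v : ℝ) = s ^ 2) :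
    (gaussianReal m v).map (fun x => (x - m) / s) = gaussianReal 0 1 := by
  have h : (fun x : ℝ => (x - m) / s) = (fun x => x / s) ∘ fun x => x - m := rfl
  rw [h, ← Measure.map_map (by fun_prop) (by fun_prop), gaussianReal_map_sub_const,
    gaussianReal_map_div_const, sub_self, zero_div]
  congr 1
  apply NNReal.eq
  change (v : ℝ) / s ^ 2 = 1
  rw [hv, div_self (by positivity)]

lemma measurePreserving_standardize {N : ℕ} (μ σ : Fin N → ℝ) (hσ : ∀ i, 0 < σ i) :
    MeasurePreserving (fun (x : Fin N → ℝ) i => (x i - μ i) / σ i)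
      (Measure.pi fun i => gaussianReal (μ i) ⟨(σ i) ^ 2, sq_nonneg _⟩) (stdGaussianPi N) :=
  measurePreserving_pi (f := fun i (y : ℝ) => (y - μ i) / σ i) _ _ fun i =>
    ⟨by fun_prop, gaussianReal_map_standardize (μ i) (hσ i) rfl⟩

lemma runSum_sumSqProb (t : ℝ) (N : ℕ) :
    (runSum (fun a => sumSqProb a t) (N + 1)).toReal =
      runSum (fun a => (sumSqProb a t).toReal) (N + 1) := by
  have h : (fun a => sumSqProb a t) = fun a => ENNReal.ofNNRealHom (sumSqProb a t).toNNReal :=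
    funext fun a => (ENNReal.coe_toNNReal (measure_ne_top _ _)).symm
  rw [h, ← map_runSum]
  exact map_runSum NNReal.toRealHom _ _

lemma runSum_toReal_sumSqProb {t : ℝ} (ht : 0 < t) (N : ℕ) :
    (runSum (fun a => sumSqProb a t) (N + 1)).toReal =
      1 + ∑ r ∈ Finset.Icc 1 N, ∑ M ∈ Finset.Icc 1 (min r (N - r + 1)),
        ∑ π ∈ Finset.univ.filter (fun π : Nat.Partition r => Multiset.card π.parts = M),
          (∏ l ∈ Finset.Icc 1 r, chiSqCDF l t ^ (π.parts.count l))
            * Polynomial.eval ((N : ℝ) - r + 2 - M) (ascPochhammer ℝ M)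
            / ∏ l ∈ Finset.Icc 1 r, (Nat.factorial (π.parts.count l) : ℝ) := by
  rw [runSum_sumSqProb, runSum_eq_one_add_sum _ (by simp [sumSqProb_zero, ht])]
  congr 1
  refine Finset.sum_congr rfl fun r _ => Finset.sum_congr rfl fun M _ =>
    Finset.sum_congr rfl fun π _ => ?_
  rw [Finset.prod_congr rfl fun l hl => by
    rw [sumSqProb_eq_chiSqCDF (Finset.mem_Icc.1 hl).1 ht]]

lemma measurableSet_exists_pos (N : ℕ) : MeasurableSet {x : Fin N → ℝ | ∃ i, 0 < x i} := by
  simp only [Set.ofPred_exists]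
  exact MeasurableSet.iUnion fun i => measurableSet_lt measurable_const (measurable_pi_apply i)

lemma cond_exists_pos_blocksBelow {t : ℝ} (ht : 0 < t) {N : ℕ} (hN : 1 ≤ N) :
    (stdGaussianPi N)[|{x | ∃ i, 0 < x i}] {x | BlocksBelow t 0 x} =
      ENNReal.ofReal ((1 / ((2 : ℝ) ^ N - 1)) *
        ((runSum (fun a => sumSqProb a t) (N + 1)).toReal - 1)) := by
  have hEc : {x : Fin N → ℝ | ∃ i, 0 < x i}ᶜ = {x | ∀ i, x i ≤ 0} := by
    ext; simp
  have hEm := measurableSet_exists_pos N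
  have hsub : {x : Fin N → ℝ | ∃ i, 0 < x i}ᶜ ⊆ {x | BlocksBelow t 0 x} := by
    rw [hEc]
    intro x hx
    refine (forall_isSuccessRun_iff_blocksBelow ht x).1 fun A hA => ?_
    obtain ⟨i, hi⟩ := hA.1
    exact absurd (hA.2.1 i hi) (hx i).not_gt
  have hE : (stdGaussianPi N).real {x | ∃ i, 0 < x i} = 1 - (2 ^ N)⁻¹ := by
    rw [← compl_compl {x : Fin N → ℝ | ∃ i, 0 < x i}, probReal_compl_eq_one_sub hEm.compl, hEc,
      Measure.real, stdGaussianPi_forall_nonpos]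
    simp
  have hB : (2 : ℝ) ^ N * (stdGaussianPi N).real {x | BlocksBelow t 0 x} =
      (runSum (fun a => sumSqProb a t) (N + 1)).toReal := by
    rw [← two_pow_mul_measure_blocksBelow_zero ht]
    simp [Measure.real]
  have hEB : (stdGaussianPi N).real ({x | ∃ i, 0 < x i} ∩ {x | BlocksBelow t 0 x}) =
      (stdGaussianPi N).real {x | BlocksBelow t 0 x} - (2 ^ N)⁻¹ := by
    have h := measureReal_inter_add_sdiff (μ := stdGaussianPi N)
      (s := {x | BlocksBelow t 0 x}) hEm
    rw [Set.sdiff_eq, Set.inter_eq_right.2 hsub, probReal_compl_eq_one_sub hEm, hE,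
      Set.inter_comm] at h
    linarith
  rw [← ENNReal.ofReal_toReal (measure_ne_top _ {x : Fin N → ℝ | BlocksBelow t 0 x})]
  congr 1
  rw [← hB, cond_apply hEm, ENNReal.toReal_mul, ENNReal.toReal_inv]
  change ((stdGaussianPi N).real _)⁻¹ * (stdGaussianPi N).real _ = _
  rw [hE, hEB]
  have h1 : (1 : ℝ) < 2 ^ N := one_lt_pow₀ one_lt_two (by omega)
  have h2 : (2 : ℝ) ^ N - 1 ≠ 0 := by linarith
  have h3 : (1 : ℝ) - (2 ^ N)⁻¹ = (2 ^ N - 1) / 2 ^ N := by field_simp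
  rw [h3]
  field_simp

/-- Let `X₁, …, X_N` (`N ≥ 1`) be independent with `Xᵢ ~ N(μᵢ, σᵢ²)`, `σᵢ > 0` (the
underlying measure being the product of the `N` Gaussian measures on `ℝ^N`). Index `i` is a
success if `Xᵢ > μᵢ`; each success run `A` has weight `∑_{i ∈ A} (Xᵢ - μᵢ)²/σᵢ²`, and `T`
is the largest weight of a success run. For every real `t > 0`, the conditional probability
`P(T < t | at least one success occurs)` equals
`(2^N - 1)⁻¹ ∑_{r=1}^N ∑_{M=1}^{min(r,N-r+1)} ∑_π [∏_l F_l(t)^{n_l}] (N-r+2-M)_M / ∏_l n_l!`,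
the inner sum over partitions `π` of `r` into exactly `M` parts, `n_l` the number of parts
of `π` equal to `l`, `(x)_n` the ascending Pochhammer symbol and `F_l` the chi-squared CDF
with `l` degrees of freedom. -/
theorem cond_prob_max_run_weight_lt (N : ℕ) (hN : 1 ≤ N) (μ : Fin N → ℝ) (σ : Fin N → ℝ)
    (hσ : ∀ i, 0 < σ i) (t : ℝ) (ht : 0 < t) :
    (Measure.pi fun i => gaussianReal (μ i) ⟨(σ i) ^ 2, sq_nonneg _⟩)[|{x : Fin N → ℝ | ∃ i, μ i < x i}]
        {x : Fin N → ℝ |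
          ∀ A : Finset (Fin N), IsSuccessRun (fun i => μ i < x i) A →
            ∑ i ∈ A, (x i - μ i) ^ 2 / (σ i) ^ 2 < t}
      = ENNReal.ofReal ((1 / ((2 : ℝ) ^ N - 1)) *
          ∑ r ∈ Finset.Icc 1 N, ∑ M ∈ Finset.Icc 1 (min r (N - r + 1)),
            ∑ π ∈ Finset.univ.filter (fun π : Nat.Partition r => Multiset.card π.parts = M),
              (∏ l ∈ Finset.Icc 1 r, chiSqCDF l t ^ (π.parts.count l))
                * Polynomial.eval ((N : ℝ) - r + 2 - M) (ascPochhammer ℝ M)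
                / ∏ l ∈ Finset.Icc 1 r, (Nat.factorial (π.parts.count l) : ℝ)) := by
  have hφ := measurePreserving_standardize μ σ hσ
  have hpos : ∀ (x : Fin N → ℝ) i, μ i < x i ↔ 0 < (x i - μ i) / σ i := fun x i => by
    rw [div_pos_iff_of_pos_right (hσ i), sub_pos]
  have hEm := measurableSet_exists_pos N
  have hE : {x : Fin N → ℝ | ∃ i, μ i < x i} =
      (fun (x : Fin N → ℝ) i => (x i - μ i) / σ i) ⁻¹' {x | ∃ i, 0 < x i} := by
    ext x
    exact exists_congr fun i => hpos x i
  have hT : {x : Fin N → ℝ | ∀ A : Finset (Fin N), IsSuccessRun (fun i => μ i < x i) A →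
        ∑ i ∈ A, (x i - μ i) ^ 2 / (σ i) ^ 2 < t} =
      (fun (x : Fin N → ℝ) i => (x i - μ i) / σ i) ⁻¹' {x | BlocksBelow t 0 x} := by
    ext x
    simp only [Set.mem_preimage, Set.mem_ofPred_eq, ← forall_isSuccessRun_iff_blocksBelow ht,
      div_pow, hpos]
  have hBm := measurableSet_blocksBelow N t 0
  rw [hE, hT, cond_apply (hφ.measurable hEm), ← Set.preimage_inter,
    hφ.measure_preimage hEm.nullMeasurableSet,
    hφ.measure_preimage (hEm.inter hBm).nullMeasurableSet, ← cond_apply hEm,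
    cond_exists_pos_blocksBelow ht hN, runSum_toReal_sumSqProb ht, add_sub_cancel_left]
end
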